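/- arXiv:2011.08997 — 6 statements merged into one kernel-verified Lean document; each statement's English description precedes it below -/
import Mathlib

section
/- Let H : ℝ^d → ℝ be differentiable with L_H-Lipschitz gradient on ℝ^d (L_H > 0), let δ > 0, and let x ∈ ℝ^d satisfy 0 < H(x) ≤ δ and ‖∇H(x)‖ ≥ √(2 L_H δ). Then the point z = x − (2δ/‖∇H(x)‖²) ∇H(x) satisfies H(z) ≤ 0 and ‖z − x‖ ≤ √(2δ/L_H). -/
open RealInnerProductSpace

abbrev E (d : ℕ) := EuclideanSpace ℝ (Fin d)

/-- The descent inequality for a differentiable function with Lipschitz gradient. -/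
theorem descent_inequality {F : Type*} [NormedAddCommGroup F] [InnerProductSpace ℝ F]
    [CompleteSpace F] {f : F → ℝ} {L : ℝ} (hf : Differentiable ℝ f)
    (hlip : ∀ x y : F, ‖gradient f y - gradient f x‖ ≤ L * ‖y - x‖) (x v : F) :
    f (x + v) ≤ f x + ⟪gradient f x, v⟫ + L / 2 * ‖v‖ ^ 2 := by
  have hderiv (t : ℝ) : HasDerivAt
      (fun t : ℝ => f (x + t • v) - t * ⟪gradient f x, v⟫ - L / 2 * ‖v‖ ^ 2 * t ^ 2)
      (⟪gradient f (x + t • v) - gradient f x, v⟫ - L * ‖v‖ ^ 2 * t) t := by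
    have hline : HasDerivAt (fun t : ℝ => x + t • v) v t := by
      simpa using ((hasDerivAt_id t).smul_const v).const_add x
    have hcomp := (hf (x + t • v)).hasGradientAt.hasFDerivAt.comp_hasDerivAt t hline
    have hsub := (hcomp.sub ((hasDerivAt_id t).mul_const ⟪gradient f x, v⟫)).sub
      ((hasDerivAt_pow 2 t).const_mul (L / 2 * ‖v‖ ^ 2))
    refine hsub.congr_deriv ?_
    simp only [InnerProductSpace.toDual_apply_apply, inner_sub_left]
    push_cast
    ring
  have hanti := antitoneOn_of_deriv_nonpos (convex_Icc (0 : ℝ) 1)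
    (fun t _ => (hderiv t).continuousAt.continuousWithinAt)
    (fun t _ => (hderiv t).differentiableAt.differentiableWithinAt) fun t ht => by
      rw [interior_Icc] at ht
      rw [(hderiv t).deriv, sub_nonpos]
      calc ⟪gradient f (x + t • v) - gradient f x, v⟫
          ≤ ‖gradient f (x + t • v) - gradient f x‖ * ‖v‖ := real_inner_le_norm _ _
        _ ≤ L * ‖x + t • v - x‖ * ‖v‖ := by gcongr; exact hlip _ _
        _ = L * ‖v‖ ^ 2 * t := by
          rw [add_sub_cancel_left, norm_smul, Real.norm_of_nonneg ht.1.le]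
          ring
  have h := hanti (Set.left_mem_Icc.2 zero_le_one) (Set.right_mem_Icc.2 zero_le_one) zero_le_one
  simp only [one_smul, zero_smul, add_zero] at h
  linarith

theorem stmt8 {d : ℕ} (H : E d → ℝ) (LH δ : ℝ) (hLH : 0 < LH) (hδ : 0 < δ)
    (hHd : Differentiable ℝ H)
    (hlip : ∀ x y : E d, ‖gradient H y - gradient H x‖ ≤ LH * ‖y - x‖)
    (x : E d) (hx0 : 0 < H x) (hxδ : H x ≤ δ)
    (hgrad : Real.sqrt (2 * LH * δ) ≤ ‖gradient H x‖) :
    H (x - (2 * δ / ‖gradient H x‖ ^ 2) • gradient H x) ≤ 0 ∧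
    ‖(x - (2 * δ / ‖gradient H x‖ ^ 2) • gradient H x) - x‖ ≤ Real.sqrt (2 * δ / LH) := by
  have hg : 0 < ‖gradient H x‖ := (Real.sqrt_pos.2 (by positivity)).trans_le hgrad
  have hsq : 2 * LH * δ ≤ ‖gradient H x‖ ^ 2 := (Real.sqrt_le_left hg.le).1 hgrad
  have hnorm : ‖-((2 * δ / ‖gradient H x‖ ^ 2) • gradient H x)‖ = 2 * δ / ‖gradient H x‖ := by
    rw [norm_neg, norm_smul, Real.norm_of_nonneg (by positivity)]
    field_simp
  have hstep : (2 * δ / ‖gradient H x‖) ^ 2 ≤ 2 * δ / LH := by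
    rw [div_pow, div_le_div_iff₀ (by positivity) hLH]
    nlinarith [mul_le_mul_of_nonneg_left hsq (by positivity : 0 ≤ 2 * δ)]
  constructor
  · have hinner : ⟪gradient H x, -((2 * δ / ‖gradient H x‖ ^ 2) • gradient H x)⟫ = -(2 * δ) := by
      rw [inner_neg_right, real_inner_smul_right, real_inner_self_eq_norm_sq]
      field_simp
    have hdesc := descent_inequality hHd hlip x (-((2 * δ / ‖gradient H x‖ ^ 2) • gradient H x))
    rw [hinner, hnorm, ← sub_eq_add_neg] at hdesc
    have hquad : LH / 2 * (2 * δ / ‖gradient H x‖) ^ 2 ≤ δ := by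
      calc LH / 2 * (2 * δ / ‖gradient H x‖) ^ 2 ≤ LH / 2 * (2 * δ / LH) := by gcongr
        _ = δ := by field_simp
    linarith
  · rw [sub_sub_cancel_left, hnorm]
    exact Real.le_sqrt_of_sq_le hstep
end

section
/- Let X ⊆ ℝ^d be a nonempty, convex, compact set. Let J : ℝ^d → ℝ be differentiable with G := sup_{x∈X} ‖∇J(x)‖ < ∞, and let H : ℝ^d → ℝ be differentiable with L_H-Lipschitz gradient on ℝ^d (L_H > 0). Let δ > 0 satisfy ‖∇H(x)‖ ≥ √(2 L_H δ) for every x with 0 < H(x) ≤ δ, and assume the feasible set {x : H(x) ≤ 0} is nonempty and contained in X. If x* is a global minimizer of J over {x ∈ X : H(x) ≤ 0} and x_δ* is a global minimizer of J over {x ∈ X : H(x) ≤ δ}, then 0 ≤ J(x*) − J(x_δ*) ≤ G·√(2δ/L_H). -/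
open RealInnerProductSpace

/-- The descent lemma: a quadratic upper bound for functions with Lipschitz gradient. -/
theorem le_add_inner_gradient_add_sq {F : Type*} [NormedAddCommGroup F] [InnerProductSpace ℝ F]
    [CompleteSpace F] {f : F → ℝ} (hf : Differentiable ℝ f) {L : ℝ}
    (hL : ∀ x y, ‖gradient f y - gradient f x‖ ≤ L * ‖y - x‖) (x v : F) :
    f (x + v) ≤ f x + ⟪gradient f x, v⟫ + L / 2 * ‖v‖ ^ 2 := by
  set ψ : ℝ → ℝ := fun s => f (x + s • v) - s * ⟪gradient f x, v⟫ - L / 2 * ‖v‖ ^ 2 * s ^ 2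
    with hψ
  have hderiv (s : ℝ) : HasDerivAt ψ
      (⟪gradient f (x + s • v) - gradient f x, v⟫ - L * ‖v‖ ^ 2 * s) s := by
    have hline : HasDerivAt (fun s : ℝ => x + s • v) v s := by
      simpa using ((hasDerivAt_id s).smul_const v).const_add x
    have hcomp := (hf (x + s • v)).hasGradientAt.hasFDerivAt.comp_hasDerivAt s hline
    rw [InnerProductSpace.toDual_apply_apply] at hcomp
    have hlin := (hasDerivAt_id s).mul_const ⟪gradient f x, v⟫
    have hquad := ((hasDerivAt_id s).pow 2).const_mul (L / 2 * ‖v‖ ^ 2)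
    refine ((hcomp.sub hlin).sub hquad).congr_deriv ?_
    rw [inner_sub_left]
    simp only [id]
    norm_num
    ring
  have hanti : AntitoneOn ψ (Set.Icc 0 1) := by
    refine antitoneOn_of_deriv_nonpos (convex_Icc 0 1)
      (fun s _ => (hderiv s).continuousAt.continuousWithinAt)
      (fun s _ => (hderiv s).differentiableAt.differentiableWithinAt) fun s hs => ?_
    rw [interior_Icc] at hs
    rw [(hderiv s).deriv, sub_nonpos]
    have hlip := hL x (x + s • v)
    rw [add_sub_cancel_left, norm_smul, Real.norm_of_nonneg hs.1.le] at hlip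
    calc ⟪gradient f (x + s • v) - gradient f x, v⟫
        ≤ ‖gradient f (x + s • v) - gradient f x‖ * ‖v‖ := real_inner_le_norm _ _
      _ ≤ L * (s * ‖v‖) * ‖v‖ := by gcongr
      _ = L * ‖v‖ ^ 2 * s := by ring
  have h01 : ψ 1 ≤ ψ 0 := hanti (by simp) (by simp) zero_le_one
  simp only [hψ, one_smul, zero_smul, add_zero] at h01
  linarith

/-- Moving a distance `t` along the normalized negative gradient. -/
theorem exists_norm_sub_eq_and_le_sub_mul_norm_gradient {F : Type*} [NormedAddCommGroup F]
    [InnerProductSpace ℝ F] [CompleteSpace F] {f : F → ℝ} (hf : Differentiable ℝ f) {L : ℝ}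
    (hL : ∀ x y, ‖gradient f y - gradient f x‖ ≤ L * ‖y - x‖) {x : F}
    (hx : gradient f x ≠ 0) {t : ℝ} (ht : 0 ≤ t) :
    ∃ y, ‖y - x‖ = t ∧ f y ≤ f x - t * ‖gradient f x‖ + L / 2 * t ^ 2 := by
  have hn : ‖gradient f x‖ ≠ 0 := norm_ne_zero_iff.mpr hx
  set v : F := -((t / ‖gradient f x‖) • gradient f x) with hv
  have hnorm : ‖v‖ = t := by
    rw [hv, norm_neg, norm_smul, Real.norm_of_nonneg (by positivity), div_mul_cancel₀ _ hn]
  have hinner : ⟪gradient f x, v⟫ = -(t * ‖gradient f x‖) := by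
    rw [hv, inner_neg_right, real_inner_smul_right, real_inner_self_eq_norm_sq]
    field_simp
  refine ⟨x + v, by rw [add_sub_cancel_left, hnorm], ?_⟩
  have h := le_add_inner_gradient_add_sq hf hL x v
  rw [hinner, hnorm] at h
  linarith

theorem stmt9 {d : ℕ} (X : Set (E d)) (hXne : X.Nonempty) (hXconv : Convex ℝ X)
    (hXcpt : IsCompact X)
    (J H : E d → ℝ) (hJd : Differentiable ℝ J) (hHd : Differentiable ℝ H)
    (G : ℝ) (hG : IsLUB ((fun x => ‖gradient J x‖) '' X) G)
    (LH : ℝ) (hLH : 0 < LH)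
    (hHlip : ∀ x y : E d, ‖gradient H y - gradient H x‖ ≤ LH * ‖y - x‖)
    (δ : ℝ) (hδ : 0 < δ)
    (hgrad : ∀ x : E d, 0 < H x → H x ≤ δ → Real.sqrt (2 * LH * δ) ≤ ‖gradient H x‖)
    (hfeas_ne : {x : E d | H x ≤ 0}.Nonempty)
    (hfeas_sub : {x : E d | H x ≤ 0} ⊆ X)
    (xs : E d) (hxsX : xs ∈ X) (hxsH : H xs ≤ 0)
    (hxsmin : ∀ x ∈ X, H x ≤ 0 → J xs ≤ J x)
    (xδ : E d) (hxδX : xδ ∈ X) (hxδH : H xδ ≤ δ)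
    (hxδmin : ∀ x ∈ X, H x ≤ δ → J xδ ≤ J x) :
    0 ≤ J xs - J xδ ∧ J xs - J xδ ≤ G * Real.sqrt (2 * δ / LH) := by
  have hG0 : 0 ≤ G := (norm_nonneg _).trans (hG.1 ⟨xδ, hxδX, rfl⟩)
  refine ⟨sub_nonneg.mpr (hxδmin xs hxsX (hxsH.trans hδ.le)), ?_⟩
  rcases le_or_gt (H xδ) 0 with hle | hpos
  · have h := hxsmin xδ hxδX hle
    have hbound : 0 ≤ G * Real.sqrt (2 * δ / LH) := by positivity
    linarith
  have hg := hgrad xδ hpos hxδH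
  have hg0 : gradient H xδ ≠ 0 :=
    norm_pos_iff.mp ((Real.sqrt_pos.mpr (by positivity)).trans_le hg)
  obtain ⟨y, hy, hHy⟩ := exists_norm_sub_eq_and_le_sub_mul_norm_gradient hHd hHlip hg0
    (Real.sqrt_nonneg (2 * δ / LH))
  have hprod : Real.sqrt (2 * δ / LH) * Real.sqrt (2 * LH * δ) = 2 * δ := by
    rw [← Real.sqrt_mul (by positivity), show 2 * δ / LH * (2 * LH * δ) = (2 * δ) ^ 2 by field_simp,
      Real.sqrt_sq (by positivity)]
  have hsq : LH / 2 * Real.sqrt (2 * δ / LH) ^ 2 = δ := by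
    rw [Real.sq_sqrt (by positivity)]
    field_simp
  have hdecr := mul_le_mul_of_nonneg_left hg (Real.sqrt_nonneg (2 * δ / LH))
  have hy0 : H y ≤ 0 := by linarith
  have hyX : y ∈ X := hfeas_sub hy0
  have hmv : ‖J y - J xδ‖ ≤ G * ‖y - xδ‖ := by
    refine hXconv.norm_image_sub_le_of_norm_fderiv_le (𝕜 := ℝ) (fun x _ => hJd x)
      (fun x hx => ?_) hxδX hyX
    have h : ‖gradient J x‖ ≤ G := hG.1 ⟨x, hx, rfl⟩
    rwa [gradient, LinearIsometryEquiv.norm_map] at h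
  rw [hy] at hmv
  linarith [hxsmin y hyX hy0, (le_abs_self (J y - J xδ)).trans hmv]
end

section
/- Let X ⊆ ℝ^d be a nonempty, convex, compact set. Let J : ℝ^d → ℝ be differentiable with L_J-Lipschitz gradient on X and G_J := sup_{x∈X} ‖∇J(x)‖ < ∞, and let H : ℝ^d → ℝ be differentiable with L_H-Lipschitz gradient on ℝ^d (L_H > 0). Let δ > 0 satisfy ‖∇H(x)‖ ≥ √(2 L_H δ) for every x with 0 < H(x) ≤ δ, and assume {x : H(x) ≤ 0} is nonempty and contained in X. Let q_1, …, q_{t+1} ∈ X with q_{t+1} a global minimizer of the data-driven minorant J_t^- over {x ∈ X : H_t^-(x) ≤ 0}, where J_t^- and H_t^- are built from q_1,…,q_t with constants L_J and L_H respectively. Suppose the set S = {q_i : 1 ≤ i ≤ t+1, H(q_i) ≤ δ} is nonempty, let x‡ ∈ S attain min_{q∈S} J(q), set Δ = J(x‡) − J_t^-(q_{t+1}), and let x* be a global minimizer of J over {x ∈ X : H(x) ≤ 0}. Then −G_J·√(2δ/L_H) ≤ J(x‡) − J(x*) ≤ Δ; moreover, if H(x‡) ≤ 0, then 0 ≤ J(x‡)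 − J(x*) ≤ Δ. -/
open RealInnerProductSpace

/-- Data-driven minorant `f_t^-` built from query points `q 1, …, q t`. -/
noncomputable def minorant {d : ℕ} (f : E d → ℝ) (L : ℝ) (t : ℕ)
    (q : ℕ → E d) (x : E d) : ℝ :=
  ⨆ i : Set.Icc 1 t, (f (q i) + ⟪gradient f (q i), x - q i⟫ - L / 2 * ‖x - q i‖ ^ 2)

/-- Descent lemma: the first-order Taylor remainder of a function whose gradient is `L`-Lipschitz
on a convex set is at most quadratic there. -/
theorem abs_sub_inner_gradient_le {d : ℕ} {f : E d → ℝ} (hf : Differentiable ℝ f) {X : Set (E d)}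
    (hX : Convex ℝ X) {L : ℝ}
    (hL : ∀ x ∈ X, ∀ y ∈ X, ‖gradient f y - gradient f x‖ ≤ L * ‖y - x‖)
    {x y : E d} (hx : x ∈ X) (hy : y ∈ X) :
    |f y - f x - ⟪gradient f x, y - x⟫| ≤ L / 2 * ‖y - x‖ ^ 2 := by
  set v := y - x with hv
  have hpath (s : ℝ) : HasDerivAt (fun s : ℝ => x + s • v) v s := by
    simpa using ((hasDerivAt_id s).smul_const v).const_add x
  have hder (s : ℝ) : HasDerivAt (fun s : ℝ => f (x + s • v) - f x - s * ⟪gradient f x, v⟫)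
      ⟪gradient f (x + s • v) - gradient f x, v⟫ s := by
    have h := ((hf (x + s • v)).hasGradientAt.hasFDerivAt.comp_hasDerivAt s (hpath s)).sub_const
      (f x) |>.sub ((hasDerivAt_id s).mul_const ⟪gradient f x, v⟫)
    exact h.congr_deriv (by simp [inner_sub_left])
  have hbound (s : ℝ) : HasDerivAt (fun s : ℝ => L / 2 * ‖v‖ ^ 2 * s ^ 2) (L * s * ‖v‖ ^ 2) s := by
    refine ((hasDerivAt_pow 2 s).const_mul (L / 2 * ‖v‖ ^ 2)).congr_deriv ?_
    push_cast
    ring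
  have key := image_norm_le_of_norm_deriv_right_le_deriv_boundary (a := 0) (b := 1)
    (fun s _ => (hder s).continuousAt.continuousWithinAt) (fun s _ => (hder s).hasDerivWithinAt)
    (by simp) hbound
    (fun s hs => ?_) (Set.right_mem_Icc.2 zero_le_one)
  · simpa [hv] using key
  · have hz : x + s • v ∈ X := hX.add_smul_sub_mem hx hy (Set.Ico_subset_Icc_self hs)
    calc ‖⟪gradient f (x + s • v) - gradient f x, v⟫‖
        ≤ ‖gradient f (x + s • v) - gradient f x‖ * ‖v‖ := norm_inner_le_norm _ _
      _ ≤ L * ‖x + s • v - x‖ * ‖v‖ := by gcongr; exact hL x hx _ hz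
      _ = L * s * ‖v‖ ^ 2 := by
        rw [add_sub_cancel_left, norm_smul, Real.norm_of_nonneg hs.1]
        ring

theorem minorant_le {d : ℕ} {f : E d → ℝ} (hf : Differentiable ℝ f) {X : Set (E d)}
    (hX : Convex ℝ X) {L : ℝ}
    (hL : ∀ x ∈ X, ∀ y ∈ X, ‖gradient f y - gradient f x‖ ≤ L * ‖y - x‖)
    {t : ℕ} (ht : 1 ≤ t) {q : ℕ → E d} (hq : ∀ i ∈ Set.Icc 1 t, q i ∈ X)
    {x : E d} (hx : x ∈ X) : minorant f L t q x ≤ f x := by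
  have : Nonempty (Set.Icc 1 t) := ⟨⟨1, le_rfl, ht⟩⟩
  refine ciSup_le fun i => ?_
  linarith [(abs_le.1 (abs_sub_inner_gradient_le hf hX hL (hq i i.2) hx)).1]

/-- A point `x` with `f x ≤ δ` is within distance `√(2 δ / L)` of the sublevel set `f ≤ 0`,
provided the gradient of `f` is `L`-Lipschitz and has norm at least `√(2 L δ)` at `x`. -/
theorem exists_nonpos_norm_sub_le {d : ℕ} {f : E d → ℝ} (hf : Differentiable ℝ f) {L : ℝ}
    (hL₀ : 0 < L) (hL : ∀ x y : E d, ‖gradient f y - gradient f x‖ ≤ L * ‖y - x‖)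
    {δ : ℝ} (hδ : 0 < δ) {x : E d} (hx : f x ≤ δ)
    (hgrad : Real.sqrt (2 * L * δ) ≤ ‖gradient f x‖) :
    ∃ y, f y ≤ 0 ∧ ‖y - x‖ ≤ Real.sqrt (2 * δ / L) := by
  set g := gradient f x
  set r := Real.sqrt (2 * δ / L) with hr
  have hr₀ : 0 ≤ r := Real.sqrt_nonneg _
  have hg : 0 < ‖g‖ := (Real.sqrt_pos.2 (by positivity)).trans_le hgrad
  have hLr : L * r ^ 2 = 2 * δ := by
    rw [hr, Real.sq_sqrt (by positivity)]
    field_simp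
  have hprod : r * Real.sqrt (2 * L * δ) = 2 * δ := by
    rw [hr, ← Real.sqrt_mul (by positivity), show 2 * δ / L * (2 * L * δ) = (2 * δ) ^ 2 by
      field_simp]
    exact Real.sqrt_sq (by positivity)
  have hnorm : ‖-(r / ‖g‖) • g‖ = r := by
    rw [norm_smul, norm_neg, Real.norm_of_nonneg (by positivity), div_mul_cancel₀ _ hg.ne']
  have hinner : ⟪g, -(r / ‖g‖) • g⟫ = -(r * ‖g‖) := by
    rw [real_inner_smul_right, real_inner_self_eq_norm_sq]
    field_simp
  refine ⟨x + -(r / ‖g‖) • g, ?_, by rw [add_sub_cancel_left, hnorm]⟩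
  have h := (abs_le.1 (abs_sub_inner_gradient_le hf convex_univ (fun x _ y _ => hL x y)
    (Set.mem_univ x) (Set.mem_univ (x + -(r / ‖g‖) • g)))).2
  rw [add_sub_cancel_left, hnorm, hinner] at h
  linarith [mul_le_mul_of_nonneg_left hgrad hr₀]

theorem stmt11 {d : ℕ} (X : Set (E d)) (hXne : X.Nonempty) (hXconv : Convex ℝ X)
    (hXcpt : IsCompact X)
    (J H : E d → ℝ) (hJd : Differentiable ℝ J) (hHd : Differentiable ℝ H)
    (LJ : ℝ)
    (hJlip : ∀ x ∈ X, ∀ y ∈ X, ‖gradient J y - gradient J x‖ ≤ LJ * ‖y - x‖)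
    (GJ : ℝ) (hGJ : IsLUB ((fun x => ‖gradient J x‖) '' X) GJ)
    (LH : ℝ) (hLH : 0 < LH)
    (hHlip : ∀ x y : E d, ‖gradient H y - gradient H x‖ ≤ LH * ‖y - x‖)
    (δ : ℝ) (hδ : 0 < δ)
    (hgrad : ∀ x : E d, 0 < H x → H x ≤ δ → Real.sqrt (2 * LH * δ) ≤ ‖gradient H x‖)
    (hfeas_ne : {x : E d | H x ≤ 0}.Nonempty)
    (hfeas_sub : {x : E d | H x ≤ 0} ⊆ X)
    (t : ℕ) (ht : 1 ≤ t) (q : ℕ → E d) (hq : ∀ i ∈ Set.Icc 1 (t + 1), q i ∈ X)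
    (hsurr_feas : minorant H LH t q (q (t + 1)) ≤ 0)
    (hsurr_min : ∀ x ∈ X, minorant H LH t q x ≤ 0 →
      minorant J LJ t q (q (t + 1)) ≤ minorant J LJ t q x)
    (j : ℕ) (hjmem : j ∈ Set.Icc 1 (t + 1)) (hjδ : H (q j) ≤ δ)
    (hjmin : ∀ i ∈ Set.Icc 1 (t + 1), H (q i) ≤ δ → J (q j) ≤ J (q i))
    (xs : E d) (hxsX : xs ∈ X) (hxsH : H xs ≤ 0)
    (hxsmin : ∀ x ∈ X, H x ≤ 0 → J xs ≤ J x) :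
    (-(GJ * Real.sqrt (2 * δ / LH)) ≤ J (q j) - J xs ∧
      J (q j) - J xs ≤ J (q j) - minorant J LJ t q (q (t + 1))) ∧
    (H (q j) ≤ 0 →
      0 ≤ J (q j) - J xs ∧
      J (q j) - J xs ≤ J (q j) - minorant J LJ t q (q (t + 1))) := by
  have hupper : minorant J LJ t q (q (t + 1)) ≤ J xs := by
    have hq' : ∀ i ∈ Set.Icc 1 t, q i ∈ X := fun i hi => hq i ⟨hi.1, hi.2.trans t.le_succ⟩
    have hH : minorant H LH t q xs ≤ H xs :=
      minorant_le hHd hXconv (fun x _ y _ => hHlip x y) ht hq' hxsX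
    exact (hsurr_min xs hxsX (hH.trans hxsH)).trans (minorant_le hJd hXconv hJlip ht hq' hxsX)
  have hGJ_le : ∀ x ∈ X, ‖gradient J x‖ ≤ GJ := fun x hx => hGJ.1 ⟨x, hx, rfl⟩
  have hGJ₀ : 0 ≤ GJ := (norm_nonneg _).trans (hGJ_le xs hxsX)
  have hqX : q j ∈ X := hq j hjmem
  refine ⟨⟨?_, by linarith⟩, fun hj => ⟨sub_nonneg.2 (hxsmin _ hqX hj), by linarith⟩⟩
  rcases le_or_gt (H (q j)) 0 with hj | hj
  · linarith [hxsmin _ hqX hj, mul_nonneg hGJ₀ (Real.sqrt_nonneg (2 * δ / LH))]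
  · obtain ⟨y, hyH, hy⟩ :=
      exists_nonpos_norm_sub_le hHd hLH hHlip hδ hjδ (hgrad _ hj hjδ)
    have hyX : y ∈ X := hfeas_sub hyH
    have hlip : ‖J y - J (q j)‖ ≤ GJ * ‖y - q j‖ :=
      hXconv.norm_image_sub_le_of_norm_hasFDerivWithin_le
        (fun z _ => (hJd z).hasGradientAt.hasFDerivAt.hasFDerivWithinAt)
        (fun z hz => (LinearIsometryEquiv.norm_map _ _).trans_le (hGJ_le z hz)) hqX hyX
    linarith [(abs_le.1 hlip).2, mul_le_mul_of_nonneg_left hy hGJ₀, hxsmin y hyX hyH]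
end

section
/- Let X ⊆ ℝ^d be a nonempty, convex, compact set, let H : ℝ^d → ℝ be differentiable with L_H-Lipschitz gradient on X, let q_1, …, q_t ∈ X, and let H_t^-(x) = max_{1≤i≤t} ( H(q_i) + ∇H(q_i)·(x − q_i) − (L_H/2)‖x − q_i‖² ). Define γ = −min( inf_{x∈X} H_t^-(x), 0 ). Then γ ≥ 0 and the set {x ∈ X : H(x) < −γ} is empty, i.e., the problem of minimizing any objective subject to x ∈ X and H(x) < −γ is infeasible. -/
open RealInnerProductSpace

/-- The lower half of the descent lemma on a convex set. -/
theorem lower_quadratic_bound_of_gradient_lipschitz {F : Type*} [NormedAddCommGroup F]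
    [InnerProductSpace ℝ F] [CompleteSpace F] {X : Set F} (hX : Convex ℝ X) {f : F → ℝ} {L : ℝ}
    (hf : Differentiable ℝ f)
    (hlip : ∀ x ∈ X, ∀ y ∈ X, ‖gradient f y - gradient f x‖ ≤ L * ‖y - x‖)
    {x y : F} (hx : x ∈ X) (hy : y ∈ X) :
    f x + ⟪gradient f x, y - x⟫ - L / 2 * ‖y - x‖ ^ 2 ≤ f y := by
  set v := y - x with hv
  have hline (s : ℝ) : HasDerivAt (fun s : ℝ => f (x + s • v)) ⟪gradient f (x + s • v), v⟫ s := by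
    have h1 : HasDerivAt (fun s : ℝ => x + s • v) v s := by
      simpa using ((hasDerivAt_id s).smul_const v).const_add x
    exact (hf (x + s • v)).hasGradientAt.hasFDerivAt.comp_hasDerivAt s h1
  have hder (s : ℝ) : HasDerivAt
      (fun s : ℝ => f (x + s • v) - s * ⟪gradient f x, v⟫ + L / 2 * ‖v‖ ^ 2 * s ^ 2)
      (⟪gradient f (x + s • v), v⟫ - ⟪gradient f x, v⟫ + L * ‖v‖ ^ 2 * s) s := by
    have h1 := ((hline s).sub ((hasDerivAt_id s).mul_const ⟪gradient f x, v⟫)).add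
      ((hasDerivAt_pow 2 s).const_mul (L / 2 * ‖v‖ ^ 2))
    refine h1.congr_deriv ?_
    push_cast
    ring
  have hmono : MonotoneOn
      (fun s : ℝ => f (x + s • v) - s * ⟪gradient f x, v⟫ + L / 2 * ‖v‖ ^ 2 * s ^ 2)
      (Set.Icc 0 1) := by
    refine monotoneOn_of_hasDerivWithinAt_nonneg (convex_Icc 0 1)
      (fun s _ => (hder s).continuousAt.continuousWithinAt)
      (fun s _ => (hder s).hasDerivWithinAt) fun s hs => ?_
    replace hs := interior_subset hs
    have hb := hlip x hx _ (hX.add_smul_sub_mem hx hy hs)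
    rw [← hv, add_sub_cancel_left, norm_smul, Real.norm_of_nonneg hs.1] at hb
    have hc := (abs_le.mp (abs_real_inner_le_norm (gradient f (x + s • v) - gradient f x) v)).1
    rw [inner_sub_left] at hc
    nlinarith [mul_le_mul_of_nonneg_right hb (norm_nonneg v)]
  have h := hmono (Set.left_mem_Icc.mpr zero_le_one) (Set.right_mem_Icc.mpr zero_le_one) zero_le_one
  have hxy : x + v = y := add_sub_cancel x y
  simp only [zero_smul, add_zero, one_smul, hxy] at h
  linarith

theorem le_minorant {d : ℕ} (f : E d → ℝ) (L : ℝ) {t : ℕ} (q : ℕ → E d) (x : E d) {i : ℕ}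
    (hi : i ∈ Set.Icc 1 t) :
    f (q i) + ⟪gradient f (q i), x - q i⟫ - L / 2 * ‖x - q i‖ ^ 2 ≤ minorant f L t q x :=
  le_ciSup (f := fun i : Set.Icc 1 t =>
    f (q i) + ⟪gradient f (q i), x - q i⟫ - L / 2 * ‖x - q i‖ ^ 2)
    (Set.finite_range _).bddAbove ⟨i, hi⟩

theorem bddBelow_range_minorant {d : ℕ} {X : Set (E d)} (hX : IsCompact X) (f : E d → ℝ) (L : ℝ)
    {t : ℕ} (ht : 1 ≤ t) (q : ℕ → E d) :
    BddBelow (Set.range fun x : X => minorant f L t q x) := by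
  obtain ⟨m, hm⟩ := hX.bddBelow_image (f := fun x : E d =>
    f (q 1) + ⟪gradient f (q 1), x - q 1⟫ - L / 2 * ‖x - q 1‖ ^ 2)
    (Continuous.continuousOn (by fun_prop))
  refine ⟨m, ?_⟩
  rintro _ ⟨x, rfl⟩
  exact (hm ⟨x, x.2, rfl⟩).trans (le_minorant f L q x ⟨le_rfl, ht⟩)

theorem stmt12 {d : ℕ} (X : Set (E d)) (hXne : X.Nonempty) (hXconv : Convex ℝ X)
    (hXcpt : IsCompact X)
    (H : E d → ℝ) (LH : ℝ) (hHd : Differentiable ℝ H)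
    (hlip : ∀ x ∈ X, ∀ y ∈ X, ‖gradient H y - gradient H x‖ ≤ LH * ‖y - x‖)
    (t : ℕ) (ht : 1 ≤ t) (q : ℕ → E d) (hq : ∀ i ∈ Set.Icc 1 t, q i ∈ X)
    (γ : ℝ) (hγ : γ = -(min (⨅ x : X, minorant H LH t q x) 0)) :
    0 ≤ γ ∧ {x ∈ X | H x < -γ} = ∅ := by
  refine ⟨by rw [hγ]; exact neg_nonneg.mpr (min_le_right _ _), ?_⟩
  refine Set.eq_empty_of_forall_notMem fun x ⟨hx, hlt⟩ => hlt.not_ge ?_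
  have : Nonempty (Set.Icc 1 t) := ⟨⟨1, le_rfl, ht⟩⟩
  calc -γ ≤ ⨅ x : X, minorant H LH t q x := by rw [hγ, neg_neg]; exact min_le_left _ _
    _ ≤ minorant H LH t q x := ciInf_le (bddBelow_range_minorant hXcpt H LH ht q) ⟨x, hx⟩
    _ ≤ H x := ciSup_le fun i =>
      lower_quadratic_bound_of_gradient_lipschitz hXconv hHd hlip (hq i i.2) hx
end

section
/- Let X ⊆ ℝ^d be a nonempty, convex, compact set. Let J : ℝ^d → ℝ be differentiable with L_J-Lipschitz gradient on X, and let H : ℝ^d → ℝ be differentiable, L_H-smooth on X, and μ-convex on X with 0 < μ ≤ L_H. Let q_1, …, q_{t+1} ∈ X satisfy H(q_i) ≤ 0 for all i. Let ξ be a global minimizer of the data-driven minorant J_t^- (built from q_1,…,q_t with constant L_J) over the set {x ∈ X : H_t^{sc}(x) ≤ 0}, where H_t^{sc}(x) = max_{1≤i≤t} ( H(q_i) + ∇H(q_i)·(x − q_i) + (μ/2)‖x − q_i‖² ), and let x* be a global minimizer of J over {x ∈ X : H(x) ≤ 0}. Then J_t^-(ξ) ≤ J(x*) ≤ min_{1≤i≤t+1}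 J(q_i); in particular, any query x‡ attaining min_{1≤i≤t+1} J(q_i) satisfies H(x‡) ≤ 0 and 0 ≤ J(x‡) − J(x*) ≤ Δ, where Δ = min_{1≤i≤t+1} J(q_i) − J_t^-(ξ). -/
open RealInnerProductSpace

/-- Strongly-convex data-driven minorant `f_t^{sc}` built from `q 1, …, q t`. -/
noncomputable def scMinorant {d : ℕ} (f : E d → ℝ) (μ : ℝ) (t : ℕ)
    (q : ℕ → E d) (x : E d) : ℝ :=
  ⨆ i : Set.Icc 1 t, (f (q i) + ⟪gradient f (q i), x - q i⟫ + μ / 2 * ‖x - q i‖ ^ 2)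

/-- Lower half of the descent lemma: a function whose gradient is `L`-Lipschitz on a convex set
lies above each of its concave quadratic models with curvature `L`. -/
theorem quadratic_lower_bound_of_gradient_lipschitz
    {F : Type*} [NormedAddCommGroup F] [InnerProductSpace ℝ F] [CompleteSpace F]
    {X : Set F} (hX : Convex ℝ X) {f : F → ℝ} (hf : Differentiable ℝ f) {L : ℝ}
    (hL : ∀ x ∈ X, ∀ y ∈ X, ‖gradient f y - gradient f x‖ ≤ L * ‖y - x‖)
    {x y : F} (hx : x ∈ X) (hy : y ∈ X) :
    f x + ⟪gradient f x, y - x⟫ - L / 2 * ‖y - x‖ ^ 2 ≤ f y := by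
  set v := y - x with hv
  have hderiv : ∀ s : ℝ, HasDerivAt
      (fun s : ℝ => f (x + s • v) - s * ⟪gradient f x, v⟫ + L / 2 * ‖v‖ ^ 2 * s ^ 2)
      (⟪gradient f (x + s • v), v⟫ - ⟪gradient f x, v⟫ + L * s * ‖v‖ ^ 2) s := by
    intro s
    have hline : HasDerivAt (fun s : ℝ => x + s • v) v s := by
      simpa using ((hasDerivAt_id s).smul_const v).const_add x
    have hcomp : HasDerivAt (fun s : ℝ => f (x + s • v)) ⟪gradient f (x + s • v), v⟫ s := by
      have h := (hf (x + s • v)).hasGradientAt.hasFDerivAt.comp_hasDerivAt s hline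
      rwa [InnerProductSpace.toDual_apply_apply] at h
    refine ((hcomp.sub ((hasDerivAt_id s).mul_const ⟪gradient f x, v⟫)).add
      ((hasDerivAt_pow 2 s).const_mul (L / 2 * ‖v‖ ^ 2))).congr_deriv ?_
    push_cast
    ring
  have hmono : MonotoneOn
      (fun s : ℝ => f (x + s • v) - s * ⟪gradient f x, v⟫ + L / 2 * ‖v‖ ^ 2 * s ^ 2)
      (Set.Icc 0 1) := by
    refine monotoneOn_of_hasDerivWithinAt_nonneg (convex_Icc 0 1)
      (fun s _ => (hderiv s).continuousAt.continuousWithinAt)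
      (fun s _ => (hderiv s).hasDerivWithinAt) fun s hs => ?_
    have hs' : s ∈ Set.Icc (0 : ℝ) 1 := interior_subset hs
    have hmem : x + s • v ∈ X := hX.add_smul_sub_mem hx hy hs'
    have hgrad := hL x hx _ hmem
    rw [add_sub_cancel_left, norm_smul, Real.norm_of_nonneg hs'.1] at hgrad
    have hinner := neg_le_of_abs_le
      (abs_real_inner_le_norm (gradient f (x + s • v) - gradient f x) v)
    rw [inner_sub_left] at hinner
    nlinarith [mul_le_mul_of_nonneg_right hgrad (norm_nonneg v)]
  have h01 := hmono (Set.left_mem_Icc.2 zero_le_one) (Set.right_mem_Icc.2 zero_le_one) zero_le_one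
  simp only [zero_smul, one_smul, add_zero, hv, add_sub_cancel] at h01
  linarith

theorem stmt15 {d : ℕ} (X : Set (E d)) (hXne : X.Nonempty) (hXconv : Convex ℝ X)
    (hXcpt : IsCompact X)
    (J H : E d → ℝ) (hJd : Differentiable ℝ J) (hHd : Differentiable ℝ H)
    (LJ LH μ : ℝ) (hμ : 0 < μ) (hμLH : μ ≤ LH)
    (hJlip : ∀ x ∈ X, ∀ y ∈ X, ‖gradient J y - gradient J x‖ ≤ LJ * ‖y - x‖)
    (hHlip : ∀ x ∈ X, ∀ y ∈ X, ‖gradient H y - gradient H x‖ ≤ LH * ‖y - x‖)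
    (hHconv : ∀ x ∈ X, ∀ y ∈ X,
      H x + ⟪gradient H x, y - x⟫ + μ / 2 * ‖y - x‖ ^ 2 ≤ H y)
    (t : ℕ) (ht : 1 ≤ t) (q : ℕ → E d)
    (hq : ∀ i ∈ Set.Icc 1 (t + 1), q i ∈ X)
    (hqfeas : ∀ i ∈ Set.Icc 1 (t + 1), H (q i) ≤ 0)
    (ξ : E d) (hξX : ξ ∈ X) (hξfeas : scMinorant H μ t q ξ ≤ 0)
    (hξmin : ∀ x ∈ X, scMinorant H μ t q x ≤ 0 →
      minorant J LJ t q ξ ≤ minorant J LJ t q x)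
    (xs : E d) (hxsX : xs ∈ X) (hxsH : H xs ≤ 0)
    (hxsmin : ∀ x ∈ X, H x ≤ 0 → J xs ≤ J x) :
    minorant J LJ t q ξ ≤ J xs ∧
    J xs ≤ (⨅ i : Set.Icc 1 (t + 1), J (q i)) ∧
    ∀ j ∈ Set.Icc 1 (t + 1), (∀ i ∈ Set.Icc 1 (t + 1), J (q j) ≤ J (q i)) →
      H (q j) ≤ 0 ∧ 0 ≤ J (q j) - J xs ∧
      J (q j) - J xs ≤ (⨅ i : Set.Icc 1 (t + 1), J (q i)) - minorant J LJ t q ξ := by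
  have : Nonempty (Set.Icc 1 t) := ⟨⟨1, le_rfl, ht⟩⟩
  have : Nonempty (Set.Icc 1 (t + 1)) := ⟨⟨1, le_rfl, by lia⟩⟩
  have hqX : ∀ i : Set.Icc 1 t, q i ∈ X := fun i =>
    hq i ⟨i.2.1, i.2.2.trans t.le_succ⟩
  have hlower : minorant J LJ t q ξ ≤ J xs :=
    (hξmin xs hxsX (ciSup_le fun i => (hHconv _ (hqX i) xs hxsX).trans hxsH)).trans
      (ciSup_le fun i =>
        quadratic_lower_bound_of_gradient_lipschitz hXconv hJd hJlip (hqX i) hxsX)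
  refine ⟨hlower, le_ciInf fun i => hxsmin _ (hq i i.2) (hqfeas i i.2), fun j hj hjmin => ?_⟩
  have hjle : J (q j) ≤ ⨅ i : Set.Icc 1 (t + 1), J (q i) := le_ciInf fun i => hjmin i i.2
  exact ⟨hqfeas j hj, sub_nonneg.2 (hxsmin _ (hq j hj) (hqfeas j hj)), sub_le_sub hjle hlower⟩
end

section
/- Let H : ℝ^d → ℝ be differentiable, let q_1, …, q_t ∈ ℝ^d, let μ > 0, L_H > 0, and define H_t^{sc}(x) = max_{1≤i≤t} ( H(q_i) + ∇H(q_i)·(x − q_i) + (μ/2)‖x − q_i‖² ) and H_t^+(x) = min_{1≤i≤t} ( H(q_i) + ∇H(q_i)·(x − q_i) + (L_H/2)‖x − q_i‖² ). Suppose ξ, q ∈ ℝ^d satisfy H_t^{sc}(ξ) ≤ H_t^+(q), and let G ≥ ‖∇H(q_i)‖ for all i ∈ {1,…,t}. Then for every i ∈ {1,…,t}, μ‖ξ − q_i‖² ≤ 2‖∇H(q_i)‖·‖q − ξ‖ + L_H‖q − q_i‖²; consequently, min_{1≤i≤t} ‖ξ − q_i‖² ≤ (2G/μ)‖q − ξ‖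 + (L_H/μ)·min_{1≤i≤t} ‖q − q_i‖². -/
open RealInnerProductSpace

/-- Data-driven majorant `f_t^+` built from query points `q 1, …, q t`. -/
noncomputable def majorant {d : ℕ} (f : E d → ℝ) (L : ℝ) (t : ℕ)
    (q : ℕ → E d) (x : E d) : ℝ :=
  ⨅ i : Set.Icc 1 t, (f (q i) + ⟪gradient f (q i), x - q i⟫ + L / 2 * ‖x - q i‖ ^ 2)

theorem stmt16 {d : ℕ} (H : E d → ℝ) (hHd : Differentiable ℝ H)
    (t : ℕ) (ht : 1 ≤ t) (q : ℕ → E d)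
    (μ LH : ℝ) (hμ : 0 < μ) (hLH : 0 < LH)
    (ξ p : E d) (hle : scMinorant H μ t q ξ ≤ majorant H LH t q p)
    (G : ℝ) (hG : ∀ i ∈ Set.Icc 1 t, ‖gradient H (q i)‖ ≤ G) :
    (∀ i ∈ Set.Icc 1 t,
      μ * ‖ξ - q i‖ ^ 2 ≤ 2 * ‖gradient H (q i)‖ * ‖p - ξ‖ + LH * ‖p - q i‖ ^ 2) ∧
    (⨅ i : Set.Icc 1 t, ‖ξ - q i‖ ^ 2) ≤
      2 * G / μ * ‖p - ξ‖ + LH / μ * ⨅ i : Set.Icc 1 t, ‖p - q i‖ ^ 2 := by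
  have bound : ∀ i ∈ Set.Icc 1 t,
      μ * ‖ξ - q i‖ ^ 2 ≤ 2 * ‖gradient H (q i)‖ * ‖p - ξ‖ + LH * ‖p - q i‖ ^ 2 := by
    intro i hi
    have hlow := le_ciSup (Set.finite_range fun k : Set.Icc 1 t =>
      H (q k) + ⟪gradient H (q k), ξ - q k⟫ + μ / 2 * ‖ξ - q k‖ ^ 2).bddAbove ⟨i, hi⟩
    have hup := ciInf_le (Set.finite_range fun k : Set.Icc 1 t =>
      H (q k) + ⟪gradient H (q k), p - q k⟫ + LH / 2 * ‖p - q k‖ ^ 2).bddBelow ⟨i, hi⟩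
    have hchain := (hlow.trans hle).trans hup
    have hinner : ⟪gradient H (q i), p - q i⟫ =
        ⟪gradient H (q i), p - ξ⟫ + ⟪gradient H (q i), ξ - q i⟫ := by
      rw [← inner_add_right, sub_add_sub_cancel]
    have hcs := real_inner_le_norm (gradient H (q i)) (p - ξ)
    dsimp only at hchain
    linarith
  refine ⟨bound, ?_⟩
  have : Nonempty (Set.Icc 1 t) := ⟨⟨1, le_rfl, ht⟩⟩
  obtain ⟨j, hj⟩ := exists_eq_ciInf_of_finite (f := fun i : Set.Icc 1 t => ‖p - q i‖ ^ 2)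
  rw [← hj]
  refine (ciInf_le (Set.finite_range fun i : Set.Icc 1 t => ‖ξ - q i‖ ^ 2).bddBelow j).trans ?_
  have hG' := mul_le_mul_of_nonneg_right (hG j j.2) (norm_nonneg (p - ξ))
  have hsum : 2 * G / μ * ‖p - ξ‖ + LH / μ * ‖p - q j‖ ^ 2 =
      (2 * G * ‖p - ξ‖ + LH * ‖p - q j‖ ^ 2) / μ := by ring
  rw [hsum, le_div_iff₀ hμ]
  linarith [bound j j.2]
end
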